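/- Let (X_η, S) be a hereditary B-free subshift and let u ∈ {0,1}^ℤ be the sequence with u(0) = 1 and u(n) = 0 for n ≠ 0 (so u ∈ X_η by heredity). Then for every automorphism τ of (X_η, S) there exists k ∈ ℤ such that τ(u) = S^k u. -/

import Mathlib

open Filter Set

noncomputable section

/-- The shift by `t`: `(shiftPow t x) n = x (n + t)`, i.e. `S^t`. -/
def shiftPow (t : ℤ) (x : ℤ → Bool) : ℤ → Bool := fun n => x (n + t)

/-- The left shift `S`, `(S x) n = x (n + 1)`. -/
def shift : (ℤ → Bool) → (ℤ → Bool) := shiftPow 1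

/-- The support of a `0-1`-sequence. -/
def supp (x : ℤ → Bool) : Set ℤ := {n | x n = true}

/-- The all-zero sequence `0^ℤ`. -/
def zeroSeq : ℤ → Bool := fun _ => false

/-- The all-one sequence `1^ℤ`. -/
def oneSeq : ℤ → Bool := fun _ => true

/-- The sequence `u = 0^{-ℕ} 1 0^{ℕ}` with a single `1` at position `0`. -/
def uSeq : ℤ → Bool := fun n => if n = 0 then true else false

/-- The set `F_B ⊆ ℤ` of `B`-free integers. -/
def BFreeSet (B : Set ℕ) : Set ℤ := {n | ∀ b ∈ B, ¬ ((b : ℤ) ∣ n)}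

open Classical in
/-- `η`, the indicator function of the `B`-free integers. -/
noncomputable def eta (B : Set ℕ) : ℤ → Bool := fun n => if n ∈ BFreeSet B then true else false

/-- The `B`-free subshift `X_η`: the orbit closure of `η` under the shift. -/
def Xeta (B : Set ℕ) : Set (ℤ → Bool) := closure {x | ∃ t : ℤ, x = shiftPow t (eta B)}

/-- A set `A ⊆ ℤ` is `B`-admissible if for every `b ∈ B` some residue class
mod `b` is disjoint from `A`. -/
def IsBAdmissible (B : Set ℕ) (A : Set ℤ) : Prop :=
  ∀ b ∈ B, ∃ r : ℤ, ∀ a ∈ A, ¬ ((b : ℤ) ∣ (a - r))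

/-- The `B`-admissible subshift `X_B`. -/
def XB (B : Set ℕ) : Set (ℤ → Bool) := {x | IsBAdmissible B (supp x)}

/-- `B` is primitive: no element divides a different element. -/
def Primitive (B : Set ℕ) : Prop := ∀ a ∈ B, ∀ b ∈ B, a ∣ b → a = b

/-- `B` is an Erdős set: infinite, `1 ∉ B` (elements positive), primitive, pairwise
coprime and thin. -/
def IsErdos (B : Set ℕ) : Prop :=
  B.Infinite ∧ (∀ b ∈ B, 2 ≤ b) ∧ Primitive B ∧
    (∀ a ∈ B, ∀ b ∈ B, a ≠ b → Nat.Coprime a b) ∧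
    Summable (fun b : B => (1 : ℝ) / (b : ℝ))

/-- A cellular automaton on `X`: a continuous self-map of `X` commuting with the shift. -/
def IsCA (X : Set (ℤ → Bool)) (τ : (ℤ → Bool) → (ℤ → Bool)) : Prop :=
  Set.MapsTo τ X X ∧ ContinuousOn τ X ∧ ∀ x ∈ X, τ (shift x) = shift (τ x)

/-- Pre-injectivity of a CA on `X`. -/
def PreInjective (X : Set (ℤ → Bool)) (τ : (ℤ → Bool) → (ℤ → Bool)) : Prop :=
  ∀ x ∈ X, ∀ y ∈ X, τ x = τ y → {n : ℤ | x n ≠ y n}.Finite → x = y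

/-- `X` is hereditary. -/
def Hereditary (X : Set (ℤ → Bool)) : Prop :=
  ∀ x ∈ X, ∀ y : ℤ → Bool, (∀ n, y n ≤ x n) → y ∈ X

/-- The hereditary closure `X̃` of a set `X`. -/
def heredClosure (X : Set (ℤ → Bool)) : Set (ℤ → Bool) :=
  {y | ∃ x ∈ X, ∀ n, y n ≤ x n}

/-- `X` is a subshift: nonempty, closed and shift-invariant. -/
def IsSubshift (X : Set (ℤ → Bool)) : Prop :=
  X.Nonempty ∧ IsClosed X ∧ shift '' X = X

/-- `τ` is given by a (sliding block) code of radius `ℓ` on `X`. -/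
def HasRadius (X : Set (ℤ → Bool)) (τ : (ℤ → Bool) → (ℤ → Bool)) (ℓ : ℕ) : Prop :=
  ∀ x ∈ X, ∀ y ∈ X, ∀ n : ℤ,
    (∀ i : ℤ, n - ℓ ≤ i → i ≤ n + ℓ → x i = y i) → τ x n = τ y n

open Classical in
/-- `A ⊆ ℤ` has logarithmic density `d`. -/
noncomputable def HasLogDensity (A : Set ℤ) (d : ℝ) : Prop :=
  Tendsto (fun N : ℕ =>
      (Real.log N)⁻¹ * ∑ n ∈ Finset.Icc 1 N, (if (n : ℤ) ∈ A then (1 : ℝ) / (n : ℝ) else 0))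
    atTop (nhds d)

/-- `B` is taut: removing any `b ∈ B` strictly increases the logarithmic density of the
`B`-free integers. -/
def IsTaut (B : Set ℕ) : Prop :=
  ∀ b ∈ B, ∀ d d' : ℝ,
    HasLogDensity (BFreeSet B) d → HasLogDensity (BFreeSet (B \ {b})) d' → d < d'

/-- `x` and `y` are proximal: along some sequence `r k → ∞`, the shifted sequences
`S^{r k} x` and `S^{r k} y` agree on arbitrarily large central windows, i.e.
`d(S^{r k} x, S^{r k} y) → 0` in the product topology. -/
def ProximalPair (x y : ℤ → Bool) : Prop :=
  ∃ r : ℕ → ℤ, Tendsto r atTop atTop ∧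
    ∀ m : ℕ, ∀ᶠ k in atTop, ∀ n : ℤ, |n| ≤ (m : ℤ) →
      shiftPow (r k) x n = shiftPow (r k) y n

/-- A subshift is proximal if every pair of its points is proximal. -/
def IsProximalSubshift (X : Set (ℤ → Bool)) : Prop :=
  ∀ x ∈ X, ∀ y ∈ X, ProximalPair x y

end

/-- A point lies in `X_η` iff each of its central windows occurs in `η`. -/
theorem mem_Xeta_iff {B : Set ℕ} {x : ℤ → Bool} :
    x ∈ Xeta B ↔ ∀ n : ℕ, ∃ t : ℤ, ∀ i : ℤ, |i| ≤ n → x i = eta B (i + t) := by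
  unfold Xeta
  rw [mem_closure_iff]
  constructor
  · intro h n
    obtain ⟨y, hy, t, rfl⟩ := h ((Icc (-n : ℤ) n).pi fun i => {x i})
      (isOpen_set_pi (Set.finite_Icc _ _) fun _ _ => isOpen_discrete _) (fun i _ => rfl)
    exact ⟨t, fun i hi => (hy i (abs_le.mp hi)).symm⟩
  · intro h o ho hxo
    obtain ⟨I, v, hv, hIv⟩ := isOpen_pi_iff.mp ho x hxo
    obtain ⟨t, ht⟩ := h (I.sup Int.natAbs)
    refine ⟨shiftPow t (eta B), hIv fun i hi => ?_, t, rfl⟩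
    have hle : i.natAbs ≤ I.sup Int.natAbs := Finset.le_sup (f := Int.natAbs) hi
    have := ht i (by rw [Int.abs_eq_natAbs]; omega)
    change eta B (i + t) ∈ v i
    exact this ▸ (hv i hi).2

theorem eta_eq_true_iff {B : Set ℕ} {n : ℤ} : eta B n = true ↔ n ∈ BFreeSet B := by
  simp [eta]

theorem eta_mem_Xeta (B : Set ℕ) : eta B ∈ Xeta B :=
  mem_Xeta_iff.mpr fun _ => ⟨0, fun i _ => by rw [add_zero]⟩

theorem shiftPow_mem_Xeta {B : Set ℕ} {x : ℤ → Bool} (hx : x ∈ Xeta B) (t : ℤ) :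
    shiftPow t x ∈ Xeta B := by
  rw [mem_Xeta_iff] at hx ⊢
  intro n
  obtain ⟨s, hs⟩ := hx (n + t.natAbs)
  refine ⟨t + s, fun i hi => ?_⟩
  have := hs (i + t) (by push_cast; grind)
  rw [← add_assoc, ← this, shiftPow]

theorem shiftPow_add (s t : ℤ) (x : ℤ → Bool) :
    shiftPow s (shiftPow t x) = shiftPow (s + t) x := by
  funext n
  simp only [shiftPow, add_assoc]

/-- A cellular automaton on `X_η` commutes with all powers of the shift. -/
theorem IsCA.map_shiftPow {B : Set ℕ} {τ : (ℤ → Bool) → (ℤ → Bool)} (hτ : IsCA (Xeta B) τ)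
    {x : ℤ → Bool} (hx : x ∈ Xeta B) (t : ℤ) : τ (shiftPow t x) = shiftPow t (τ x) := by
  have hpos : ∀ (k : ℕ) (y : ℤ → Bool), y ∈ Xeta B →
      τ (shiftPow k y) = shiftPow k (τ y) := by
    intro k
    induction k with
    | zero =>
      intro y _
      have h0 : ∀ z : ℤ → Bool, shiftPow 0 z = z := fun z => by funext n; simp [shiftPow]
      simp [h0]
    | succ k ih =>
      intro y hy
      have h := hτ.2.2 _ (shiftPow_mem_Xeta hy k)
      simp only [shift, shiftPow_add, ih y hy] at h
      push_cast
      rw [add_comm (k : ℤ) 1, h]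
  have hcancel : ∀ (s : ℤ) (z : ℤ → Bool), shiftPow (-s) (shiftPow s z) = z := by
    intro s z
    funext n
    simp [shiftPow]
  obtain ⟨k, rfl | rfl⟩ := t.eq_nat_or_neg
  · exact hpos k x hx
  · have h := hpos k _ (shiftPow_mem_Xeta hx (-k))
    have hx' : shiftPow (k : ℤ) (shiftPow (-k) x) = x := by
      simpa using hcancel (-k) x
    rw [hx'] at h
    rw [h, hcancel]

theorem one_mem_BFreeSet {B : Set ℕ} (hB : ∀ b ∈ B, 2 ≤ b) : (1 : ℤ) ∈ BFreeSet B := by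
  intro b hb hd
  have := Int.le_of_dvd one_pos hd
  have := hB b hb
  omega

theorem neg_one_mem_BFreeSet {B : Set ℕ} (hB : ∀ b ∈ B, 2 ≤ b) : (-1 : ℤ) ∈ BFreeSet B :=
  fun b hb hd => one_mem_BFreeSet hB b hb ((dvd_neg).mp hd)

theorem zeroSeq_mem_Xeta {B : Set ℕ} (hhered : Hereditary (Xeta B)) : zeroSeq ∈ Xeta B :=
  hhered _ (eta_mem_Xeta B) _ fun _ => Bool.false_le _

theorem uSeq_mem_Xeta {B : Set ℕ} (hB : ∀ b ∈ B, 2 ≤ b) (hhered : Hereditary (Xeta B)) :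
    uSeq ∈ Xeta B := by
  refine hhered _ (shiftPow_mem_Xeta (eta_mem_Xeta B) 1) _ fun n => ?_
  by_cases hn : n = 0
  · subst hn
    have : shiftPow 1 (eta B) 0 = true := by
      simpa [shiftPow] using eta_eq_true_iff.mpr (one_mem_BFreeSet hB)
    rw [this]
    exact Bool.le_true _
  · simp [uSeq, hn]

/-- If `0^ℤ ∈ X_η`, then every nonzero integer is coprime to some element of `B`. -/
theorem exists_isCoprime_of_zeroSeq_mem {B : Set ℕ} (h0 : zeroSeq ∈ Xeta B) {D : ℤ}
    (hD : D ≠ 0) : ∃ b ∈ B, IsCoprime D (b : ℤ) := by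
  obtain ⟨t, ht⟩ := mem_Xeta_iff.mp h0 D.natAbs
  have hlt := Int.emod_lt_abs (1 - t) hD
  rw [Int.abs_eq_natAbs] at hlt
  have hnn := Int.emod_nonneg (1 - t) hD
  have hz := ht ((1 - t) % D) (by rw [abs_of_nonneg hnn]; omega)
  have hnot : (1 - t) % D + t ∉ BFreeSet B := by
    rw [← eta_eq_true_iff, ← hz]
    simp [zeroSeq]
  simp only [BFreeSet, mem_ofPred_eq, not_forall, not_not] at hnot
  obtain ⟨b, hb, c, hc⟩ := hnot
  refine ⟨b, hb, (1 - t) / D, c, ?_⟩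
  have := Int.emod_add_mul_ediv (1 - t) D
  linarith

theorem BFreeSet_infinite_of_uSeq_mem {B : Set ℕ} (hB : ∀ b ∈ B, 2 ≤ b)
    (hu : uSeq ∈ Xeta B) : (BFreeSet B).Infinite := by
  intro hfin
  set M := hfin.toFinset.sup Int.natAbs
  have hM : ∀ m ∈ BFreeSet B, m.natAbs ≤ M := fun m hm =>
    Finset.le_sup (f := Int.natAbs) (hfin.mem_toFinset.mpr hm)
  obtain ⟨t, ht⟩ := mem_Xeta_iff.mp hu (M + 1)
  have h0 := ht 0 (by rw [abs_zero]; positivity)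
  have htB : t ∈ BFreeSet B := by
    rw [← eta_eq_true_iff, ← zero_add t, ← h0]
    rfl
  have htM := hM t htB
  have key : ∀ e ∈ BFreeSet B, |e| ≤ 1 → e = t := by
    intro e he he1
    have hetM : |e - t| ≤ (M + 1 : ℕ) := by
      rw [Int.abs_eq_natAbs] at he1 ⊢
      omega
    have h := ht (e - t) hetM
    rw [sub_add_cancel, eta_eq_true_iff.mpr he] at h
    have : e - t = 0 := by simpa [uSeq] using h
    omega
  have h1 := key 1 (one_mem_BFreeSet hB) (by simp)
  have h2 := key (-1) (neg_one_mem_BFreeSet hB) (by simp)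
  omega

/-- Finitely many infinite sets of integers admit representatives that are pairwise far apart. -/
theorem exists_sparse_selection {ι : Type*} (s : Finset ι) (S : ι → Set ℤ)
    (hS : ∀ i, (S i).Infinite) (L : ℕ) :
    ∃ a : ι → ℤ, ∀ i ∈ s, a i ∈ S i ∧ ∀ j ∈ s, i ≠ j → (L : ℤ) < |a i - a j| := by
  classical
  induction s using Finset.induction_on with
  | empty => exact ⟨fun _ => 0, by simp⟩
  | insert i s hi ih =>
    obtain ⟨a, ha⟩ := ih
    have hfin : (⋃ j ∈ s, Icc (a j - L) (a j + L)).Finite :=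
      s.finite_toSet.biUnion fun j _ => Set.finite_Icc _ _
    obtain ⟨c, hcS, hc⟩ := (hS i).exists_notMem_finite hfin
    simp only [mem_iUnion, mem_Icc, not_exists] at hc
    have hc' : ∀ j ∈ s, (L : ℤ) < |c - a j| := fun j hj => by
      have := hc j hj
      grind
    refine ⟨Function.update a i c, fun j hj => ⟨?_, fun k hk hjk => ?_⟩⟩
    · by_cases hji : j = i
      · subst hji; simpa using hcS
      · simpa [hji] using (ha j ((Finset.mem_insert.mp hj).resolve_left hji)).1
    · by_cases hji : j = i
      · subst hji
        have hks := (Finset.mem_insert.mp hk).resolve_left hjk.symm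
        simpa [hjk.symm] using hc' k hks
      · have hjs := (Finset.mem_insert.mp hj).resolve_left hji
        by_cases hki : k = i
        · subst hki
          rw [abs_sub_comm]
          simpa [hji] using hc' j hjs
        · simpa [hji, hki] using
            (ha j hjs).2 k ((Finset.mem_insert.mp hk).resolve_left hki) hjk

/-- If `τ u` has a `1` at position `f`, then so has `τ y` for every `y ∈ X` that agrees with `u`
on a sufficiently large central window. -/
theorem exists_window_of_continuousOn {X : Set (ℤ → Bool)} {τ : (ℤ → Bool) → (ℤ → Bool)}
    (hτ : ContinuousOn τ X) {u : ℤ → Bool} (hu : u ∈ X) {f : ℤ} (hf : τ u f = true) :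
    ∃ L : ℕ, ∀ y ∈ X, (∀ i : ℤ, |i| ≤ L → y i = u i) → τ y f = true := by
  have hc : ContinuousOn (fun y => τ y f) X := (continuous_apply f).comp_continuousOn hτ
  have hmem : {y | τ y f = true} ∈ nhdsWithin u X :=
    (hc u hu) ((isOpen_discrete {true}).mem_nhds hf)
  obtain ⟨o, ho, huo, hsub⟩ := mem_nhdsWithin.mp hmem
  obtain ⟨I, v, hv, hIv⟩ := isOpen_pi_iff.mp ho u huo
  refine ⟨I.sup Int.natAbs, fun y hy h => hsub ⟨hIv fun i hi => ?_, hy⟩⟩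
  have hle : i.natAbs ≤ I.sup Int.natAbs := Finset.le_sup (f := Int.natAbs) hi
  rw [h i (by rw [Int.abs_eq_natAbs]; omega)]
  exact (hv i hi).2

/-- The residue classes mod `b` that contain infinitely many `B`-free integers. -/
def frequentClasses (B : Set ℕ) (b : ℕ) : Set (ZMod b) :=
  {r | {n ∈ BFreeSet B | (n : ZMod b) = r}.Infinite}

theorem finite_infrequent (B : Set ℕ) (b : ℕ) [NeZero b] :
    {n ∈ BFreeSet B | (n : ZMod b) ∉ frequentClasses B b}.Finite := by
  have : (⋃ r ∈ (frequentClasses B b)ᶜ, {n ∈ BFreeSet B | (n : ZMod b) = r}).Finite :=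
    (Set.toFinite _).biUnion fun r hr => not_infinite.mp hr
  refine this.subset fun n hn => ?_
  simp only [mem_iUnion]
  exact ⟨n, hn.2, hn.1, rfl⟩

theorem frequentClasses_nonempty {B : Set ℕ} (hinf : (BFreeSet B).Infinite) (b : ℕ) [NeZero b] :
    (frequentClasses B b).Nonempty := by
  by_contra hne
  rw [not_nonempty_iff_eq_empty] at hne
  refine hinf ((finite_infrequent B b).subset fun n hn => ⟨hn, by simp [hne]⟩)

theorem zero_notMem_frequentClasses {B : Set ℕ} {b : ℕ} (hb : b ∈ B) :
    (0 : ZMod b) ∉ frequentClasses B b := by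
  intro h
  obtain ⟨n, hn, hn0⟩ := h.nonempty
  exact hn b hb ((ZMod.intCast_zmod_eq_zero_iff_dvd n b).mp hn0)

/-- If `τ u` has `1`s at `f` and `f'`, then a single translation `t` makes both `r ↦ r + f + t` and
`r ↦ r + f' + t` preserve the classes mod `b` with infinitely many `B`-free integers. -/
theorem exists_translate_mapsTo_frequentClasses {B : Set ℕ} (hB : ∀ b ∈ B, 2 ≤ b)
    (hhered : Hereditary (Xeta B)) {τ : (ℤ → Bool) → (ℤ → Bool)} (hτ : IsCA (Xeta B) τ)
    {f f' : ℤ} (hf : τ uSeq f = true) (hf' : τ uSeq f' = true) (b : ℕ) [NeZero b] :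
    ∃ t : ℤ, MapsTo (fun r => r + ((f + t : ℤ) : ZMod b))
        (frequentClasses B b) (frequentClasses B b) ∧
      MapsTo (fun r => r + ((f' + t : ℤ) : ZMod b))
        (frequentClasses B b) (frequentClasses B b) := by
  classical
  have hu := uSeq_mem_Xeta hB hhered
  obtain ⟨L, hL⟩ := exists_window_of_continuousOn hτ.2.1 hu hf
  obtain ⟨L', hL'⟩ := exists_window_of_continuousOn hτ.2.1 hu hf'
  set E := {n ∈ BFreeSet B | (n : ZMod b) ∉ frequentClasses B b}
  have hE : E.Finite := finite_infrequent B b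
  let ι := frequentClasses B b × Fin (E.ncard + 1)
  have : Fintype ι := Fintype.ofFinite _
  obtain ⟨a, ha⟩ := exists_sparse_selection (Finset.univ : Finset ι)
    (fun i => {n ∈ BFreeSet B | (n : ZMod b) = i.1}) (fun i => i.1.2) (max L L')
  simp only [Finset.mem_univ, true_implies] at ha
  let x : ℤ → Bool := fun n => decide (∃ i, a i = n)
  have hx : x ∈ Xeta B := by
    refine hhered _ (eta_mem_Xeta B) x fun n hn => ?_
    obtain ⟨i, rfl⟩ := of_decide_eq_true hn
    exact eta_eq_true_iff.mpr (ha i).1.1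
  have hlook : ∀ (i : ι) (m : ℤ), |m| ≤ (max L L' : ℕ) → shiftPow (a i) x m = uSeq m := by
    intro i m hm
    by_cases hm0 : m = 0
    · subst hm0
      simp [shiftPow, x, uSeq]
    · simp only [shiftPow, x, uSeq, hm0, if_false, decide_eq_false_iff_not]
      rintro ⟨j, hj⟩
      have hji : j ≠ i := by rintro rfl; omega
      have := (ha j).2 i hji
      rw [hj, add_sub_cancel_right] at this
      omega
  have hτx : ∀ i, τ x (a i + f) = true ∧ τ x (a i + f') = true := by
    intro i
    have hmem := shiftPow_mem_Xeta hx (a i)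
    have h1 := hL _ hmem fun m hm => hlook i m (hm.trans (by exact_mod_cast le_max_left _ _))
    have h2 := hL' _ hmem fun m hm => hlook i m (hm.trans (by exact_mod_cast le_max_right _ _))
    rw [hτ.map_shiftPow hx] at h1 h2
    simp only [shiftPow] at h1 h2
    rw [add_comm (a i), add_comm (a i)]
    exact ⟨h1, h2⟩
  set M := Finset.univ.sup fun i => (a i).natAbs
  have hM : ∀ i, (a i).natAbs ≤ M := fun i =>
    Finset.le_sup (f := fun i => (a i).natAbs) (Finset.mem_univ i)
  obtain ⟨t, ht⟩ := mem_Xeta_iff.mp (hτ.1 hx) (M + f.natAbs + f'.natAbs)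
  have hinj : Function.Injective a := by
    intro i j hij
    by_contra hne
    have := (ha i).2 j hne
    rw [hij, sub_self, abs_zero] at this
    omega
  have main : ∀ g : ℤ, (∀ i, a i + g + t ∈ BFreeSet B) →
      MapsTo (fun r => r + ((g + t : ℤ) : ZMod b)) (frequentClasses B b)
        (frequentClasses B b) := by
    intro g hg r hr
    by_contra hnot
    have hinj' : Function.Injective fun k : Fin (E.ncard + 1) => a (⟨r, hr⟩, k) + g + t := by
      intro k l hkl
      have : a (⟨r, hr⟩, k) = a (⟨r, hr⟩, l) := by simpa using hkl
      exact (Prod.mk.inj (hinj this)).2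
    have hsub : range (fun k : Fin (E.ncard + 1) => a (⟨r, hr⟩, k) + g + t) ⊆ E := by
      rintro _ ⟨k, rfl⟩
      refine ⟨hg _, ?_⟩
      have hk : ((a (⟨r, hr⟩, k) : ℤ) : ZMod b) = r := (ha (⟨r, hr⟩, k)).1.2
      push_cast at hnot ⊢
      rwa [hk, add_assoc]
    have hcard := Set.ncard_le_ncard hsub hE
    rw [← image_univ, ncard_image_of_injective _ hinj', ncard_univ, Nat.card_fin] at hcard
    omega
  refine ⟨t, main f fun i => ?_, main f' fun i => ?_⟩
  · rw [← eta_eq_true_iff, ← ht _ (by have := hM i; rw [Int.abs_eq_natAbs]; omega)]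
    exact (hτx i).1
  · rw [← eta_eq_true_iff, ← ht _ (by have := hM i; rw [Int.abs_eq_natAbs]; omega)]
    exact (hτx i).2

/-- A nonempty set of residues preserved by two translations whose difference is a unit contains
every residue. -/
theorem mem_of_mapsTo_add {b : ℕ} [NeZero b] {R : Set (ZMod b)} (hR : R.Nonempty)
    {c d : ZMod b} (hc : MapsTo (· + c) R R) (hd : MapsTo (· + d) R R)
    (hunit : IsUnit (c - d)) (z : ZMod b) : z ∈ R := by
  have hsurj : SurjOn (· + d) R R :=
    ((Set.toFinite R).injOn_iff_bijOn_of_mapsTo hd |>.mp (add_left_injective d).injOn).surjOn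
  have hstep : ∀ r ∈ R, r + (c - d) ∈ R := by
    intro r hr
    obtain ⟨s, hs, rfl⟩ := hsurj hr
    simpa using hc hs
  obtain ⟨r, hr⟩ := hR
  have hiter : ∀ k : ℕ, r + k * (c - d) ∈ R := by
    intro k
    induction k with
    | zero => simpa using hr
    | succ k ih =>
      have := hstep _ ih
      push_cast
      rwa [add_mul, one_mul, ← add_assoc]
  obtain ⟨v, hv⟩ := hunit.exists_left_inv
  have := hiter ((z - r) * v).val
  rwa [ZMod.natCast_zmod_val, mul_assoc, hv, mul_one, add_sub_cancel] at this

/-- A cellular automaton on a hereditary `X_η` fixes `0^ℤ`. -/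
theorem IsCA.map_zeroSeq {B : Set ℕ} (hB : ∀ b ∈ B, 2 ≤ b) (hhered : Hereditary (Xeta B))
    {τ : (ℤ → Bool) → (ℤ → Bool)} (hτ : IsCA (Xeta B) τ) : τ zeroSeq = zeroSeq := by
  have h0 := zeroSeq_mem_Xeta hhered
  have hconst : ∀ n, τ zeroSeq n = τ zeroSeq 0 := by
    intro n
    have h := congrFun (hτ.map_shiftPow h0 n) 0
    have hs : shiftPow n zeroSeq = zeroSeq := rfl
    rw [hs] at h
    simpa [shiftPow] using h.symm
  obtain ⟨b, hb, -⟩ := exists_isCoprime_of_zeroSeq_mem h0 one_ne_zero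
  by_contra hne
  have hone : ∀ n, τ zeroSeq n = true := by
    intro n
    rw [hconst]
    by_contra hfalse
    exact hne (funext fun m => by rw [hconst m]; simpa [zeroSeq] using hfalse)
  obtain ⟨t, ht⟩ := mem_Xeta_iff.mp (hτ.1 h0) b
  have hfree : ∀ i : ℤ, |i| ≤ b → i + t ∈ BFreeSet B := fun i hi => by
    rw [← eta_eq_true_iff, ← ht i hi, hone]
  have hbpos := hB b hb
  have h1 := Int.emod_lt_of_pos (-t) (show (0 : ℤ) < b by omega)
  have h2 := Int.emod_nonneg (-t) (show (b : ℤ) ≠ 0 by omega)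
  refine hfree ((-t) % b) (by rw [abs_of_nonneg h2]; omega) b hb ?_
  have := Int.emod_add_mul_ediv (-t) b
  exact ⟨-((-t) / b), by linarith⟩

/-- on a hereditary `B`-free subshift, every automorphism maps the sequence
`u = ...0001000...` to a shift of itself. -/
theorem aut_image_of_u (B : Set ℕ)
    (hBpos : ∀ b ∈ B, 2 ≤ b) (hBprim : Primitive B)
    (hhered : Hereditary (Xeta B))
    (τ : (ℤ → Bool) → (ℤ → Bool)) (hτ : IsCA (Xeta B) τ)
    (hbij : Set.BijOn τ (Xeta B) (Xeta B)) :
    ∃ k : ℤ, τ uSeq = shiftPow k uSeq := by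
  have hu := uSeq_mem_Xeta hBpos hhered
  have h0 := zeroSeq_mem_Xeta hhered
  obtain ⟨f, hf⟩ : ∃ f, τ uSeq f = true := by
    by_contra! hno
    have hτu : τ uSeq = τ zeroSeq := by
      rw [hτ.map_zeroSeq hBpos hhered]
      exact funext fun n => by simpa [zeroSeq] using hno n
    simpa [uSeq, zeroSeq] using congrFun (hbij.injOn hu h0 hτu) 0
  have huniq : ∀ f', τ uSeq f' = true → f' = f := by
    intro f' hf'
    by_contra hne
    obtain ⟨b, hb, hcop⟩ := exists_isCoprime_of_zeroSeq_mem h0 (sub_ne_zero.mpr hne)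
    have : NeZero b := ⟨by have := hBpos b hb; omega⟩
    obtain ⟨t, ht', ht⟩ :=
      exists_translate_mapsTo_frequentClasses hBpos hhered hτ hf' hf b
    refine zero_notMem_frequentClasses hb (mem_of_mapsTo_add
      (frequentClasses_nonempty (BFreeSet_infinite_of_uSeq_mem hBpos hu) b) ht' ht ?_ 0)
    rw [← Int.cast_sub, add_sub_add_right_eq_sub]
    obtain ⟨p, q, hpq⟩ := hcop
    refine IsUnit.of_mul_eq_one (p : ZMod b) ?_
    have := congrArg (Int.cast : ℤ → ZMod b) hpq
    push_cast at this ⊢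
    rw [ZMod.natCast_self, mul_zero, add_zero] at this
    rw [mul_comm, this]
  refine ⟨-f, funext fun n => ?_⟩
  by_cases hn : n = f
  · subst hn
    simpa [shiftPow, uSeq] using hf
  · have : n + -f ≠ 0 := by omega
    simp only [shiftPow, uSeq, this, if_false]
    exact Bool.eq_false_of_not_eq_true fun h => hn (huniq n h)
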